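/- arXiv:1311.5115 — 3 statements merged into one kernel-verified Lean document; each statement's English description precedes it below -/
import Mathlib

section
/- Fix γ : Fin n → ℂ, a branch index k, and a bus index i. Then the function t ↦ (Y_bus(τ, Function.update θ k t)·γ)_i has derivative at θ_k equal to Complex.I·Y_ft,k·(C_f)_{k,i}·(C_t·γ)_k − Complex.I·Y_tf,k·(C_t)_{k,i}·(C_f·γ)_k, where Y_ft, Y_tf are evaluated at (τ,θ). That is, (Y_bus·γ)_θ = C_fᵀ[C_t γ][jY_ft] + C_tᵀ[C_f γ][-jY_tf]. -/
open Matrix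

noncomputable section

/-- A real matrix viewed as a complex matrix via coercion. -/
def cmat {m n : ℕ} (A : Matrix (Fin m) (Fin n) ℝ) : Matrix (Fin m) (Fin n) ℂ :=
  A.map Complex.ofReal

/-- Y_ff,l(τ,θ) = (y_s,l + i·b_c,l/2)/τ_l². -/
def Yff {m : ℕ} (ys : Fin m → ℂ) (bc : Fin m → ℝ) (τ : Fin m → ℝ) (l : Fin m) : ℂ :=
  (ys l + Complex.I * (bc l : ℂ) / 2) / (τ l : ℂ) ^ 2

/-- Y_ft,l(τ,θ) = -y_s,l·e^{iθ_l}/τ_l. -/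
def Yft {m : ℕ} (ys : Fin m → ℂ) (τ θ : Fin m → ℝ) (l : Fin m) : ℂ :=
  -ys l * Complex.exp (Complex.I * (θ l : ℂ)) / (τ l : ℂ)

/-- Y_tf,l(τ,θ) = -y_s,l·e^{-iθ_l}/τ_l. -/
def Ytf {m : ℕ} (ys : Fin m → ℂ) (τ θ : Fin m → ℝ) (l : Fin m) : ℂ :=
  -ys l * Complex.exp (-(Complex.I * (θ l : ℂ))) / (τ l : ℂ)

/-- Y_tt,l = y_s,l + i·b_c,l/2. -/
def Ytt {m : ℕ} (ys : Fin m → ℂ) (bc : Fin m → ℝ) (l : Fin m) : ℂ :=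
  ys l + Complex.I * (bc l : ℂ) / 2

/-- The bus admittance matrix
Y_bus = C_fᵀ[Y_ff]C_f + C_fᵀ[Y_ft]C_t + C_tᵀ[Y_tf]C_f + C_tᵀ[Y_tt]C_t + [Y_sh]. -/
def Ybus {m n : ℕ} (Cf Ct : Matrix (Fin m) (Fin n) ℝ) (ys : Fin m → ℂ) (bc : Fin m → ℝ)
    (Ysh : Fin n → ℂ) (τ θ : Fin m → ℝ) : Matrix (Fin n) (Fin n) ℂ :=
  (cmat Cf)ᵀ * diagonal (Yff ys bc τ) * cmat Cf
    + (cmat Cf)ᵀ * diagonal (Yft ys τ θ) * cmat Ct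
    + (cmat Ct)ᵀ * diagonal (Ytf ys τ θ) * cmat Cf
    + (cmat Ct)ᵀ * diagonal (Ytt ys bc) * cmat Ct
    + diagonal Ysh

/-- The bus power injection vector S_bus = [V](Y_bus V)*. -/
def Sbus {m n : ℕ} (Cf Ct : Matrix (Fin m) (Fin n) ℝ) (ys : Fin m → ℂ) (bc : Fin m → ℝ)
    (Ysh : Fin n → ℂ) (V : Fin n → ℂ) (τ θ : Fin m → ℝ) (i : Fin n) : ℂ :=
  V i * (starRingEnd ℂ) ((Ybus Cf Ct ys bc Ysh τ θ).mulVec V i)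

theorem transpose_mul_diagonal_mul_mulVec {ι κ κ' R : Type*} [Fintype ι] [DecidableEq ι]
    [Fintype κ'] [CommSemiring R] (A : Matrix ι κ R) (d : ι → R) (B : Matrix ι κ' R)
    (γ : κ' → R) (i : κ) :
    (Aᵀ * diagonal d * B).mulVec γ i = ∑ l, A l i * d l * B.mulVec γ l := by
  rw [← mulVec_mulVec]
  simp only [mulVec, dotProduct, mul_diagonal, transpose_apply]

theorem hasDerivAt_transpose_mul_diagonal_mul_mulVec {ι κ κ' : Type*} [Fintype ι]
    [DecidableEq ι] [Fintype κ'] (A : Matrix ι κ ℂ) (B : Matrix ι κ' ℂ) (γ : κ' → ℂ) (i : κ)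
    {d : ℝ → ι → ℂ} {k : ι} {d' : ℂ} {x : ℝ} (hd : HasDerivAt d (Pi.single k d') x) :
    HasDerivAt (fun t => (Aᵀ * diagonal (d t) * B).mulVec γ i)
      (A k i * d' * B.mulVec γ k) x := by
  simp only [transpose_mul_diagonal_mul_mulVec]
  have h := HasDerivAt.fun_sum (u := Finset.univ) fun l _ =>
    ((hasDerivAt_pi.1 hd l).const_mul (A l i)).mul_const (B.mulVec γ l)
  refine h.congr_deriv ?_
  rw [Finset.sum_eq_single k] <;> simp +contextual

theorem hasDerivAt_comp_update {ι : Type*} [Fintype ι] [DecidableEq ι] {g : ι → ℝ → ℂ}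
    (θ : ι → ℝ) {k : ι} {g' : ℂ} (hg : HasDerivAt (g k) g' (θ k)) :
    HasDerivAt (fun t l => g l (Function.update θ k t l)) (Pi.single k g') (θ k) := by
  refine hasDerivAt_pi.2 fun l => ?_
  rcases eq_or_ne l k with rfl | hl
  · simpa using hg
  · simpa [hl] using hasDerivAt_const (θ k) (g l (θ l))

theorem hasDerivAt_Yft_update {m : ℕ} (ys : Fin m → ℂ) (τ θ : Fin m → ℝ) (k : Fin m) :
    HasDerivAt (fun t => Yft ys τ (Function.update θ k t))
      (Pi.single k (Complex.I * Yft ys τ θ k)) (θ k) := by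
  refine hasDerivAt_comp_update
    (g := fun l t => -ys l * Complex.exp (Complex.I * (t : ℂ)) / (τ l : ℂ)) θ ?_
  have h := ((((hasDerivAt_id (θ k)).ofReal_comp.const_mul Complex.I).cexp).const_mul
    (-ys k)).div_const (τ k : ℂ)
  refine h.congr_deriv ?_
  simp only [Yft, id, Complex.ofReal_one]
  ring

theorem hasDerivAt_Ytf_update {m : ℕ} (ys : Fin m → ℂ) (τ θ : Fin m → ℝ) (k : Fin m) :
    HasDerivAt (fun t => Ytf ys τ (Function.update θ k t))
      (Pi.single k (-(Complex.I * Ytf ys τ θ k))) (θ k) := by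
  refine hasDerivAt_comp_update
    (g := fun l t => -ys l * Complex.exp (-(Complex.I * (t : ℂ))) / (τ l : ℂ)) θ ?_
  have h := ((((hasDerivAt_id (θ k)).ofReal_comp.const_mul Complex.I).fun_neg.cexp).const_mul
    (-ys k)).div_const (τ k : ℂ)
  refine h.congr_deriv ?_
  simp only [Ytf, id, Complex.ofReal_one]
  ring

/-- (Y_bus·γ)_θ = C_fᵀ[C_t γ][jY_ft] + C_tᵀ[C_f γ][-jY_tf],
stated entrywise at bus `i` for the partial derivative in the phase shift angle `θ_k`. -/
theorem Ybus_mulVec_hasDerivAt_theta {m n : ℕ}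
    (Cf Ct : Matrix (Fin m) (Fin n) ℝ) (ys : Fin m → ℂ) (bc : Fin m → ℝ)
    (Ysh : Fin n → ℂ) (τ θ : Fin m → ℝ) (hτ : ∀ l, τ l ≠ 0)
    (γ : Fin n → ℂ) (k : Fin m) (i : Fin n) :
    HasDerivAt
      (fun t : ℝ => (Ybus Cf Ct ys bc Ysh τ (Function.update θ k t)).mulVec γ i)
      (Complex.I * Yft ys τ θ k * (Cf k i : ℂ) * (cmat Ct).mulVec γ k
        - Complex.I * Ytf ys τ θ k * (Ct k i : ℂ) * (cmat Cf).mulVec γ k)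
      (θ k) := by
  have hft := hasDerivAt_transpose_mul_diagonal_mul_mulVec (cmat Cf) (cmat Ct) γ i
    (hasDerivAt_Yft_update ys τ θ k)
  have htf := hasDerivAt_transpose_mul_diagonal_mul_mulVec (cmat Ct) (cmat Cf) γ i
    (hasDerivAt_Ytf_update ys τ θ k)
  simp only [Ybus, add_mulVec, Pi.add_apply]
  refine ((((hft.const_add _).fun_add htf).add_const _).add_const _).congr_deriv ?_
  simp only [cmat, map_apply]
  ring
end
end

section
/- Fix bus voltages V : Fin n → ℂ, a multiplier vector λ : Fin n → ℂ, and branch indices k, l. Let g(τ,θ) = Σ_i λ_i · S_bus(τ,θ)_i. Then the mixed second partial derivative ∂²g/∂θ_k∂τ_l (first differentiate in τ_l, then in θ_k) equals 0 if k ≠ l, and for k = l equals (1/τ_k)·( Complex.I·conj(Y_ft,k)·conj((C_t·V)_k)·(C_f·(diag V)·λ)_k − Complex.I·conj(Y_tf,k)·conj((C_f·V)_k)·(C_t·(diag V)·λ)_k ). That is, G_τθ^s(λ) = [τ]⁻¹( [C_t V*][C_f[V]λ][jY_ft*] + [C_f V*][C_t[V]λ][-jY_tf*] ). -/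
open Matrix

noncomputable section

/-- Complex conjugation of a branch term, paired with `lam` through the diagonal of voltages. -/
lemma sum_mul_conj_transpose_diagonal_mulVec {m n : ℕ} (A : Matrix (Fin m) (Fin n) ℝ)
    (B : Matrix (Fin m) (Fin n) ℂ) (d : Fin m → ℂ) (V lam : Fin n → ℂ) :
    ∑ i, lam i * (V i * (starRingEnd ℂ) (((cmat A)ᵀ * diagonal d * B).mulVec V i))
      = ∑ b, (starRingEnd ℂ) (d b) * (starRingEnd ℂ) (B.mulVec V b)
          * (cmat A * diagonal V).mulVec lam b := by
  have h : ∀ i, ((cmat A)ᵀ * diagonal d * B).mulVec V i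
      = ∑ b, (A b i : ℂ) * (d b * B.mulVec V b) := by
    intro i
    rw [← mulVec_mulVec, ← mulVec_mulVec]
    simp [mulVec, dotProduct, cmat, diagonal_apply]
  have h' : ∀ b, (cmat A * diagonal V).mulVec lam b = ∑ i, (A b i : ℂ) * (V i * lam i) := by
    intro b
    rw [← mulVec_mulVec]
    simp [mulVec, dotProduct, cmat, diagonal_apply]
  simp only [h, h', map_sum, map_mul, Complex.conj_ofReal, Finset.mul_sum]
  rw [Finset.sum_comm]
  refine Finset.sum_congr rfl fun b _ => Finset.sum_congr rfl fun i _ => ?_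
  ring

/-- The weighted power injection as a sum of branch contributions, each depending only on the
tap ratio and the phase shift of its own branch, plus a constant. -/
lemma sum_mul_Sbus_eq {m n : ℕ} (Cf Ct : Matrix (Fin m) (Fin n) ℝ) (ys : Fin m → ℂ)
    (bc : Fin m → ℝ) (Ysh V lam : Fin n → ℂ) : ∃ (a : Fin m → ℂ) (c : ℂ), ∀ τ θ : Fin m → ℝ,
    ∑ i, lam i * Sbus Cf Ct ys bc Ysh V τ θ i
      = ∑ b, (a b / (τ b : ℂ) ^ 2
          + (-(starRingEnd ℂ) (ys b) * Complex.exp (-(Complex.I * (θ b : ℂ))) / (τ b : ℂ))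
            * ((starRingEnd ℂ) ((cmat Ct).mulVec V b) * (cmat Cf * diagonal V).mulVec lam b)
          + (-(starRingEnd ℂ) (ys b) * Complex.exp (Complex.I * (θ b : ℂ)) / (τ b : ℂ))
            * ((starRingEnd ℂ) ((cmat Cf).mulVec V b) * (cmat Ct * diagonal V).mulVec lam b))
        + c := by
  refine ⟨fun b => (starRingEnd ℂ) (Ytt ys bc b) * (starRingEnd ℂ) ((cmat Cf).mulVec V b)
      * (cmat Cf * diagonal V).mulVec lam b,
    ∑ i, lam i * (V i * (starRingEnd ℂ) (((cmat Ct)ᵀ * diagonal (Ytt ys bc) * cmat Ct).mulVec V i))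
      + ∑ i, lam i * (V i * (starRingEnd ℂ) ((diagonal Ysh).mulVec V i)), fun τ θ => ?_⟩
  simp only [Sbus, Ybus, add_mulVec, Pi.add_apply, map_add, mul_add, Finset.sum_add_distrib]
  rw [← add_assoc]
  congr 2
  simp only [sum_mul_conj_transpose_diagonal_mulVec]
  congr 1
  · congr 1
    · refine Finset.sum_congr rfl fun b _ => ?_
      simp [Yff, Ytt]
      ring
    · refine Finset.sum_congr rfl fun b _ => ?_
      simp [Yft, ← Complex.exp_conj]
      ring
  · refine Finset.sum_congr rfl fun b _ => ?_
    simp [Ytf, ← Complex.exp_conj]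
    ring

/-- The derivative of a separable sum along one coordinate is that of the matching summand. -/
lemma HasDerivAt.sum_update {ι : Type*} [Fintype ι] [DecidableEq ι] {F : ι → ℝ → ℂ} {x : ι → ℝ}
    {l : ι} {f' : ℂ} {y : ℝ} (h : HasDerivAt (F l) f' y) :
    HasDerivAt (fun t : ℝ => ∑ b, F b (Function.update x l t b)) f' y := by
  have hsum : (fun t : ℝ => ∑ b, F b (Function.update x l t b))
      = fun t => F l t + ∑ b ∈ Finset.univ.erase l, F b (x b) := by
    funext t
    rw [← Finset.add_sum_erase _ _ (Finset.mem_univ l), Function.update_self]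
    congr 1
    refine Finset.sum_congr rfl fun b hb => ?_
    rw [Function.update_of_ne (Finset.ne_of_mem_erase hb)]
  rw [hsum]
  exact h.add_const _

/-- The derivative of a branch contribution with respect to its tap ratio. -/
lemma hasDerivAt_branch_tap (a p q : ℂ) {t : ℝ} (ht : t ≠ 0) (u v : ℂ) :
    HasDerivAt (fun t : ℝ => a / (t : ℂ) ^ 2 + p / (t : ℂ) * u + q / (t : ℂ) * v)
      (-2 * a / (t : ℂ) ^ 3 - (p * u + q * v) / (t : ℂ) ^ 2) t := by
  have htc : (t : ℂ) ≠ 0 := Complex.ofReal_ne_zero.mpr ht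
  have hid : HasDerivAt (fun t : ℝ => (t : ℂ)) 1 t := Complex.ofRealCLM.hasDerivAt
  have h := (((hasDerivAt_const t a).fun_div (hid.fun_pow 2) (pow_ne_zero 2 htc)).fun_add
    (((hasDerivAt_const t p).fun_div hid htc).mul_const u)).fun_add
    (((hasDerivAt_const t q).fun_div hid htc).mul_const v)
  refine h.congr_deriv ?_
  field_simp
  push_cast
  ring

/-- G_τθ^s(λ) = [τ]⁻¹( [C_t V*][C_f[V]λ][jY_ft*] + [C_f V*][C_t[V]λ][-jY_tf*] ),
stated entrywise: the iterated partial derivative of g(τ,θ) = Σᵢ λᵢ·S_bus(τ,θ)ᵢ,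
first in τ_l, then in θ_k. -/
theorem Sbus_lambda_hasDerivAt_theta_tau {m n : ℕ}
    (Cf Ct : Matrix (Fin m) (Fin n) ℝ) (ys : Fin m → ℂ) (bc : Fin m → ℝ)
    (Ysh : Fin n → ℂ) (τ θ : Fin m → ℝ) (hτ : ∀ l, τ l ≠ 0)
    (V : Fin n → ℂ) (lam : Fin n → ℂ) (k l : Fin m) :
    HasDerivAt
      (fun s : ℝ =>
        deriv
          (fun t : ℝ => ∑ i, lam i *
            Sbus Cf Ct ys bc Ysh V (Function.update τ l t) (Function.update θ k s) i)
          (τ l))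
      (if k = l then
        (1 / (τ k : ℂ)) *
          (Complex.I * (starRingEnd ℂ) (Yft ys τ θ k)
              * (starRingEnd ℂ) ((cmat Ct).mulVec V k) * (cmat Cf * diagonal V).mulVec lam k
            - Complex.I * (starRingEnd ℂ) (Ytf ys τ θ k)
              * (starRingEnd ℂ) ((cmat Cf).mulVec V k) * (cmat Ct * diagonal V).mulVec lam k)
      else 0)
      (θ k) := by
  obtain ⟨a, c, hS⟩ := sum_mul_Sbus_eq Cf Ct ys bc Ysh V lam
  have hderiv : ∀ φ : Fin m → ℝ,
      deriv (fun t : ℝ => ∑ i, lam i * Sbus Cf Ct ys bc Ysh V (Function.update τ l t) φ i) (τ l)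
        = -2 * a l / (τ l : ℂ) ^ 3
          - (-(starRingEnd ℂ) (ys l) * Complex.exp (-(Complex.I * (φ l : ℂ)))
              * ((starRingEnd ℂ) ((cmat Ct).mulVec V l) * (cmat Cf * diagonal V).mulVec lam l)
            + -(starRingEnd ℂ) (ys l) * Complex.exp (Complex.I * (φ l : ℂ))
              * ((starRingEnd ℂ) ((cmat Cf).mulVec V l) * (cmat Ct * diagonal V).mulVec lam l))
            / (τ l : ℂ) ^ 2 := by
    intro φ
    simp only [hS]
    refine (HasDerivAt.add_const c (HasDerivAt.sum_update (x := τ) (l := l)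
      (F := fun b t => a b / (t : ℂ) ^ 2
        + (-(starRingEnd ℂ) (ys b) * Complex.exp (-(Complex.I * (φ b : ℂ))) / (t : ℂ))
          * ((starRingEnd ℂ) ((cmat Ct).mulVec V b) * (cmat Cf * diagonal V).mulVec lam b)
        + (-(starRingEnd ℂ) (ys b) * Complex.exp (Complex.I * (φ b : ℂ)) / (t : ℂ))
          * ((starRingEnd ℂ) ((cmat Cf).mulVec V b) * (cmat Ct * diagonal V).mulVec lam b))
      (hasDerivAt_branch_tap _ _ _ (hτ l) _ _))).deriv
  simp only [hderiv]
  split_ifs with hkl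
  · subst hkl
    simp only [Function.update_self]
    have hτk : (τ k : ℂ) ≠ 0 := Complex.ofReal_ne_zero.mpr (hτ k)
    have hid : HasDerivAt (fun s : ℝ => Complex.I * (s : ℂ)) (Complex.I * 1) (θ k) :=
      HasDerivAt.const_mul Complex.I Complex.ofRealCLM.hasDerivAt
    have h := ((((hid.fun_neg.cexp.const_mul (-(starRingEnd ℂ) (ys k))).mul_const
        ((starRingEnd ℂ) ((cmat Ct).mulVec V k) * (cmat Cf * diagonal V).mulVec lam k)).fun_add
      ((hid.cexp.const_mul (-(starRingEnd ℂ) (ys k))).mul_const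
        ((starRingEnd ℂ) ((cmat Cf).mulVec V k) * (cmat Ct * diagonal V).mulVec lam k))).div_const
      ((τ k : ℂ) ^ 2)).const_sub (-2 * a k / (τ k : ℂ) ^ 3)
    refine h.congr_deriv ?_
    simp only [Yft, Ytf, map_div₀, map_mul, map_neg, ← Complex.exp_conj, Complex.conj_I,
      Complex.conj_ofReal, neg_mul, neg_neg]
    field_simp
    ring
  · simp only [Function.update_of_ne (Ne.symm hkl)]
    exact hasDerivAt_const _ _
end
end

section
/- Fix voltage magnitudes v : Fin n → ℝ with v_i > 0, voltage angles Θ : Fin n → ℝ, and set V_i(Θ) = v_i·e^{iΘ_i}. Fix a multiplier vector λ : Fin n → ℂ, a bus index j, and a branch index k, and let g(Θ,τ,θ) = Σ_i λ_i · S_bus(V(Θ),τ,θ)_i. Then the mixed second partial derivative ∂²g/∂Θ_j∂τ_k (first differentiate in τ_k, then in Θ_j) equals (Complex.I/τ_k)·[ V_j·λ_j·( (C_f)_{k,j}·conj((C_f·V)_k)·(−2·conj(Y_ff,k)) + (C_f)_{k,j}·conj((C_t·V)_k)·(−conj(Y_ft,k)) + (C_t)_{k,j}·conj((C_f·V)_k)·(−conj(Y_tf,k))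 ) − conj(V_j)·( (C_f)_{k,j}·(C_f·(diag V)·λ)_k·(−2·conj(Y_ff,k)) + (C_t)_{k,j}·(C_f·(diag V)·λ)_k·(−conj(Y_ft,k)) + (C_f)_{k,j}·(C_t·(diag V)·λ)_k·(−conj(Y_tf,k)) ) ]. That is, it is the (j,k) entry of G_Θτ^s(λ) = j( [V][λ]( C_fᵀ[C_fV*][−2Y_ff*] + C_fᵀ[C_tV*][−Y_ft*] + C_tᵀ[C_fV*][−Y_tf*] ) − [V*]( C_fᵀ[C_f[V]λ][−2Y_ff*] + C_tᵀ[C_f[V]λ][−Y_ft*] + C_fᵀ[C_t[V]λ][−Y_tf*] ) )[τ]⁻¹. -/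
open Matrix

noncomputable section

/-- Bus voltages V_i(Θ) = v_i·e^{iΘ_i} built from magnitudes and angles. -/
def Vof {n : ℕ} (v : Fin n → ℝ) (Θ : Fin n → ℝ) (i : Fin n) : ℂ :=
  (v i : ℂ) * Complex.exp (Complex.I * (Θ i : ℂ))

open scoped ComplexConjugate

lemma Ybus_mulVec_apply {m n : ℕ} (Cf Ct : Matrix (Fin m) (Fin n) ℝ) (ys : Fin m → ℂ)
    (bc : Fin m → ℝ) (Ysh : Fin n → ℂ) (τ θ : Fin m → ℝ) (V : Fin n → ℂ) (i : Fin n) :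
    (Ybus Cf Ct ys bc Ysh τ θ).mulVec V i =
      ∑ l, ((Cf l i : ℂ) * (Yff ys bc τ l * (cmat Cf).mulVec V l)
        + (Cf l i : ℂ) * (Yft ys τ θ l * (cmat Ct).mulVec V l)
        + (Ct l i : ℂ) * (Ytf ys τ θ l * (cmat Cf).mulVec V l)
        + (Ct l i : ℂ) * (Ytt ys bc l * (cmat Ct).mulVec V l)) + Ysh i * V i := by
  have h (A B : Matrix (Fin m) (Fin n) ℝ) (d : Fin m → ℂ) :
      ((cmat A)ᵀ * diagonal d * cmat B).mulVec V i =
        ∑ l, (A l i : ℂ) * (d l * (cmat B).mulVec V l) := by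
    rw [← mulVec_mulVec, ← mulVec_mulVec, mulVec_eq_sum, Finset.sum_apply]
    refine Finset.sum_congr rfl fun l _ => ?_
    simp [mulVec_diagonal, cmat]
  simp only [Ybus, add_mulVec, Pi.add_apply, h, mulVec_diagonal, Finset.sum_add_distrib]

lemma cmat_mul_diagonal_mulVec_apply {m n : ℕ} (A : Matrix (Fin m) (Fin n) ℝ)
    (V lam : Fin n → ℂ) (l : Fin m) :
    (cmat A * diagonal V).mulVec lam l = ∑ i, (A l i : ℂ) * V i * lam i := by
  simp [mulVec, dotProduct, cmat, mul_diagonal]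

/-- The weighted sum of bus injections, regrouped by branches. -/
lemma sum_mul_Sbus {m n : ℕ} (Cf Ct : Matrix (Fin m) (Fin n) ℝ) (ys : Fin m → ℂ)
    (bc : Fin m → ℝ) (Ysh : Fin n → ℂ) (τ θ : Fin m → ℝ) (V lam : Fin n → ℂ) :
    ∑ i, lam i * Sbus Cf Ct ys bc Ysh V τ θ i =
      ∑ l, ((cmat Cf * diagonal V).mulVec lam l * conj ((cmat Cf).mulVec V l)
            * conj (Yff ys bc τ l)
          + (cmat Cf * diagonal V).mulVec lam l * conj ((cmat Ct).mulVec V l)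
            * conj (Yft ys τ θ l)
          + (cmat Ct * diagonal V).mulVec lam l * conj ((cmat Cf).mulVec V l)
            * conj (Ytf ys τ θ l)
          + (cmat Ct * diagonal V).mulVec lam l * conj ((cmat Ct).mulVec V l)
            * conj (Ytt ys bc l))
        + ∑ i, lam i * (V i * conj (Ysh i * V i)) := by
  simp only [Sbus, Ybus_mulVec_apply, map_add, mul_add,
    Finset.sum_add_distrib (s := .univ (α := Fin n))]
  congr 1
  simp only [cmat_mul_diagonal_mulVec_apply, map_sum, Finset.mul_sum, Finset.sum_mul]
  rw [Finset.sum_comm]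
  refine Finset.sum_congr rfl fun l _ => ?_
  simp only [← Finset.sum_add_distrib]
  refine Finset.sum_congr rfl fun i _ => ?_
  simp only [map_add, map_mul, Complex.conj_ofReal]
  ring

lemma HasDerivAt.conj_comp_update {m : ℕ} {Y : (Fin m → ℝ) → Fin m → ℂ} {τ : Fin m → ℝ}
    {f : Fin m → ℝ → ℂ} (hY : ∀ σ l, Y σ l = f l (σ l)) {k : Fin m} {d : ℂ}
    (hf : HasDerivAt (f k) d (τ k)) (l : Fin m) :
    HasDerivAt (fun t : ℝ => conj (Y (Function.update τ k t) l))
      (if l = k then conj d else 0) (τ k) := by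
  by_cases h : l = k
  · subst h
    simpa [hY] using hf.star
  · simpa [hY, h] using hasDerivAt_const (τ k) (conj (f l (τ l)))

lemma hasDerivAt_const_div_ofReal (c : ℂ) {t : ℝ} (ht : t ≠ 0) :
    HasDerivAt (fun s : ℝ => c / (s : ℂ)) (-(c / t) / t) t := by
  have ht' : (t : ℂ) ≠ 0 := Complex.ofReal_ne_zero.mpr ht
  refine ((hasDerivAt_const t c).div (hasDerivAt_id t).ofReal_comp ht').congr_deriv ?_
  simp
  field_simp

lemma hasDerivAt_const_div_ofReal_sq (c : ℂ) {t : ℝ} (ht : t ≠ 0) :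
    HasDerivAt (fun s : ℝ => c / (s : ℂ) ^ 2) (-2 * (c / (t : ℂ) ^ 2) / t) t := by
  have ht' : (t : ℂ) ≠ 0 := Complex.ofReal_ne_zero.mpr ht
  refine ((hasDerivAt_const t c).div ((hasDerivAt_id t).ofReal_comp.pow 2)
    (pow_ne_zero 2 ht')).congr_deriv ?_
  simp
  field_simp

/-- First partial derivative of the weighted injection in the tap ratio `τ k`. -/
lemma hasDerivAt_sum_mul_Sbus_tau {m n : ℕ} (Cf Ct : Matrix (Fin m) (Fin n) ℝ) (ys : Fin m → ℂ)
    (bc : Fin m → ℝ) (Ysh : Fin n → ℂ) (τ θ : Fin m → ℝ) (V lam : Fin n → ℂ) (k : Fin m)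
    (hk : τ k ≠ 0) :
    HasDerivAt
      (fun t : ℝ => ∑ i, lam i * Sbus Cf Ct ys bc Ysh V (Function.update τ k t) θ i)
      ((cmat Cf * diagonal V).mulVec lam k * conj ((cmat Cf).mulVec V k)
          * (-2 * conj (Yff ys bc τ k) / τ k)
        + (cmat Cf * diagonal V).mulVec lam k * conj ((cmat Ct).mulVec V k)
          * (-conj (Yft ys τ θ k) / τ k)
        + (cmat Ct * diagonal V).mulVec lam k * conj ((cmat Cf).mulVec V k)
          * (-conj (Ytf ys τ θ k) / τ k))
      (τ k) := by
  simp only [sum_mul_Sbus]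
  have hff := HasDerivAt.conj_comp_update (Y := Yff ys bc)
    (f := fun l t => (ys l + Complex.I * (bc l : ℂ) / 2) / (t : ℂ) ^ 2) (fun _ _ => rfl)
    (hasDerivAt_const_div_ofReal_sq (ys k + Complex.I * (bc k : ℂ) / 2) hk)
  have hft := HasDerivAt.conj_comp_update (Y := fun σ => Yft ys σ θ)
    (f := fun l t => -ys l * Complex.exp (Complex.I * (θ l : ℂ)) / (t : ℂ)) (fun _ _ => rfl)
    (hasDerivAt_const_div_ofReal (-ys k * Complex.exp (Complex.I * (θ k : ℂ))) hk)
  have htf := HasDerivAt.conj_comp_update (Y := fun σ => Ytf ys σ θ)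
    (f := fun l t => -ys l * Complex.exp (-(Complex.I * (θ l : ℂ))) / (t : ℂ)) (fun _ _ => rfl)
    (hasDerivAt_const_div_ofReal (-ys k * Complex.exp (-(Complex.I * (θ k : ℂ)))) hk)
  refine (((HasDerivAt.fun_sum fun l _ => ((((hff l).const_mul _).add
    ((hft l).const_mul _)).add ((htf l).const_mul _)).add_const _).add_const _)).congr_deriv ?_
  simp [Finset.sum_add_distrib, Yff, Yft, Ytf, map_ofNat (starRingEnd ℂ) 2]

lemma hasDerivAt_Vof_update {n : ℕ} (v Θ : Fin n → ℝ) (j i : Fin n) :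
    HasDerivAt (fun s : ℝ => Vof v (Function.update Θ j s) i)
      (if i = j then Complex.I * Vof v Θ j else 0) (Θ j) := by
  by_cases h : i = j
  · subst h
    simp only [Vof, Function.update_self, if_true]
    refine ((((hasDerivAt_id (Θ i)).ofReal_comp.const_mul Complex.I).cexp).const_mul
      (v i : ℂ)).congr_deriv ?_
    simp
    ring
  · simpa [Vof, h] using hasDerivAt_const (Θ j) (Vof v Θ i)

lemma hasDerivAt_conj_cmat_mulVec_Vof {m n : ℕ} (A : Matrix (Fin m) (Fin n) ℝ)
    (v Θ : Fin n → ℝ) (j : Fin n) (k : Fin m) :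
    HasDerivAt (fun s : ℝ => conj ((cmat A).mulVec (Vof v (Function.update Θ j s)) k))
      (-Complex.I * conj (Vof v Θ j) * A k j) (Θ j) := by
  refine (HasDerivAt.fun_sum fun i _ =>
    (hasDerivAt_Vof_update v Θ j i).const_mul (cmat A k i)).star.congr_deriv ?_
  simp [cmat]
  ring

lemma hasDerivAt_cmat_mul_diagonal_Vof_mulVec {m n : ℕ} (A : Matrix (Fin m) (Fin n) ℝ)
    (v Θ : Fin n → ℝ) (lam : Fin n → ℂ) (j : Fin n) (k : Fin m) :
    HasDerivAt (fun s : ℝ => (cmat A * diagonal (Vof v (Function.update Θ j s))).mulVec lam k)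
      (Complex.I * Vof v Θ j * lam j * A k j) (Θ j) := by
  simp only [cmat_mul_diagonal_mulVec_apply]
  refine (HasDerivAt.fun_sum fun i _ =>
    ((hasDerivAt_Vof_update v Θ j i).const_mul (A k i : ℂ)).mul_const (lam i)).congr_deriv ?_
  simp
  ring

/-- The (j,k) entry of
G_Θτ^s(λ) = j( [V][λ]( C_fᵀ[C_fV*][−2Y_ff*] + C_fᵀ[C_tV*][−Y_ft*] + C_tᵀ[C_fV*][−Y_tf*] )
  − [V*]( C_fᵀ[C_f[V]λ][−2Y_ff*] + C_tᵀ[C_f[V]λ][−Y_ft*] + C_fᵀ[C_t[V]λ][−Y_tf*] ) )[τ]⁻¹,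
stated as the iterated partial derivative of g(Θ,τ,θ) = Σᵢ λᵢ·S_bus(V(Θ),τ,θ)ᵢ,
first in τ_k, then in Θ_j. -/
theorem Sbus_lambda_hasDerivAt_Theta_tau {m n : ℕ}
    (Cf Ct : Matrix (Fin m) (Fin n) ℝ) (ys : Fin m → ℂ) (bc : Fin m → ℝ)
    (Ysh : Fin n → ℂ) (τ θ : Fin m → ℝ) (hτ : ∀ l, τ l ≠ 0)
    (v : Fin n → ℝ) (hv : ∀ i, 0 < v i) (Θ : Fin n → ℝ)
    (lam : Fin n → ℂ) (j : Fin n) (k : Fin m) :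
    HasDerivAt
      (fun s : ℝ =>
        deriv
          (fun t : ℝ => ∑ i, lam i *
            Sbus Cf Ct ys bc Ysh (Vof v (Function.update Θ j s)) (Function.update τ k t) θ i)
          (τ k))
      ((Complex.I / (τ k : ℂ)) *
        (Vof v Θ j * lam j *
            ((Cf k j : ℂ) * (starRingEnd ℂ) ((cmat Cf).mulVec (Vof v Θ) k)
                * (-2 * (starRingEnd ℂ) (Yff ys bc τ k))
              + (Cf k j : ℂ) * (starRingEnd ℂ) ((cmat Ct).mulVec (Vof v Θ) k)
                * (-(starRingEnd ℂ) (Yft ys τ θ k))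
              + (Ct k j : ℂ) * (starRingEnd ℂ) ((cmat Cf).mulVec (Vof v Θ) k)
                * (-(starRingEnd ℂ) (Ytf ys τ θ k)))
          - (starRingEnd ℂ) (Vof v Θ j) *
            ((Cf k j : ℂ) * (cmat Cf * diagonal (Vof v Θ)).mulVec lam k
                * (-2 * (starRingEnd ℂ) (Yff ys bc τ k))
              + (Ct k j : ℂ) * (cmat Cf * diagonal (Vof v Θ)).mulVec lam k
                * (-(starRingEnd ℂ) (Yft ys τ θ k))
              + (Cf k j : ℂ) * (cmat Ct * diagonal (Vof v Θ)).mulVec lam k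
                * (-(starRingEnd ℂ) (Ytf ys τ θ k)))))
      (Θ j) := by
  have hderiv (s : ℝ) := (hasDerivAt_sum_mul_Sbus_tau Cf Ct ys bc Ysh τ θ
    (Vof v (Function.update Θ j s)) lam k (hτ k)).deriv
  simp only [hderiv]
  have hF := hasDerivAt_cmat_mul_diagonal_Vof_mulVec Cf v Θ lam j k
  have hT := hasDerivAt_cmat_mul_diagonal_Vof_mulVec Ct v Θ lam j k
  have hf := hasDerivAt_conj_cmat_mulVec_Vof Cf v Θ j k
  have ht := hasDerivAt_conj_cmat_mulVec_Vof Ct v Θ j k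
  refine ((((hF.mul hf).mul_const _).add ((hF.mul ht).mul_const _)).add
    ((hT.mul hf).mul_const _)).congr_deriv ?_
  simp only [Function.update_eq_self]
  ring
end
end
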